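/- arXiv:2403.04609 — 3 statements merged into one kernel-verified Lean document; each statement's English description precedes it below -/
import Mathlib

section
/- Let T be a positive integer and let d ∈ ℝ^T with d ≠ 0 be the total (day-ahead plus real-time) demand. Let G and S be nonempty finite index sets; for each j ∈ G let c_j > 0, and for each s ∈ S let b_s > 0 and let M_s be a real T×T matrix with M_s d ≠ 0. Define φ = (Σ_{j∈G} c_j⁻¹ + Σ_{s∈S} b_s⁻¹ ‖d‖²/‖M_s d‖²)⁻¹ > 0 and λ = φ d, and define the equilibrium bids α_j = c_j⁻¹ and β_s = b_s⁻¹ ‖λ‖²/‖M_s λ‖². Then: (i) Σ_{j∈G} α_j λ + Σ_{s∈S} β_s λ = d, so that if day-ahead commitments g_j^d, u_s^d ∈ ℝ^T satisfy Σ_j g_j^d + Σ_s u_s^d = d^d and d = d^d + d^r, the day-ahead-aware real-time bids g_j^r = α_j λ − g_j^d and u_s^r = β_s λ − u_s^d clear the real-time market: Σ_j g_j^r + Σ_s u_s^r = d^r; and (ii) φ is the unique nonzero real number with this clearing property, i.e., if φ' ≠ 0 and λ' = φ' d satisfy Σ_j c_j⁻¹ λ' + Σ_s b_s⁻¹ (‖λ'‖²/‖M_s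 λ'‖²) λ' = d, then φ' = φ. -/
open scoped RealInnerProductSpace

/-- The ratio `‖x‖² / ‖L x‖²` is invariant under nonzero scaling of `x`. -/
theorem norm_smul_sq_div_norm_map_smul_sq {E F : Type*} [NormedAddCommGroup E] [NormedSpace ℝ E]
    [NormedAddCommGroup F] [NormedSpace ℝ F] (L : E →ₗ[ℝ] F) (x : E) {t : ℝ} (ht : t ≠ 0) :
    ‖t • x‖ ^ 2 / ‖L (t • x)‖ ^ 2 = ‖x‖ ^ 2 / ‖L x‖ ^ 2 := by
  rw [map_smul, norm_smul, norm_smul, mul_pow, mul_pow,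
    mul_div_mul_left _ _ (pow_ne_zero 2 (norm_ne_zero_iff.mpr ht))]

/-- Existence and uniqueness of the competitive-equilibrium price
coefficient `φ` in the day-ahead-aware mixed market mechanism (Theorem 4):
(i) the equilibrium bids `α_j = c_j⁻¹`, `β_s = b_s⁻¹‖λ‖²/‖M_sλ‖²` with
`λ = φ d` clear the market (in total and, given any day-ahead commitments
clearing the day-ahead demand, in real time), and (ii) `φ` is the unique
nonzero real with this clearing property. -/
theorem da_aware_equilibrium_exists_unique
    (T : ℕ) (hT : 0 < T) (d : EuclideanSpace ℝ (Fin T)) (hd : d ≠ 0)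
    (G S : Type) [Fintype G] [Fintype S] [Nonempty G] [Nonempty S]
    (c : G → ℝ) (hc : ∀ j, 0 < c j)
    (b : S → ℝ) (hb : ∀ s, 0 < b s)
    (M : S → Matrix (Fin T) (Fin T) ℝ) (hM : ∀ s, (M s).toEuclideanLin d ≠ 0)
    (φ : ℝ)
    (hφ : φ = (∑ j, (c j)⁻¹ +
        ∑ s, (b s)⁻¹ * (‖d‖ ^ 2 / ‖(M s).toEuclideanLin d‖ ^ 2))⁻¹)
    (lam : EuclideanSpace ℝ (Fin T)) (hlam : lam = φ • d)
    (α : G → ℝ) (hα : ∀ j, α j = (c j)⁻¹)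
    (β : S → ℝ)
    (hβ : ∀ s, β s = (b s)⁻¹ * (‖lam‖ ^ 2 / ‖(M s).toEuclideanLin lam‖ ^ 2)) :
    0 < φ ∧
    ((∑ j, α j • lam) + ∑ s, β s • lam = d) ∧
    (∀ (dd dr : EuclideanSpace ℝ (Fin T)) (gd : G → EuclideanSpace ℝ (Fin T))
        (ud : S → EuclideanSpace ℝ (Fin T)),
        ((∑ j, gd j) + ∑ s, ud s = dd) → d = dd + dr →
        (∑ j, (α j • lam - gd j)) + ∑ s, (β s • lam - ud s) = dr) ∧
    (∀ φ' : ℝ, φ' ≠ 0 →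
        ((∑ j, (c j)⁻¹ • (φ' • d)) +
            ∑ s, ((b s)⁻¹ *
              (‖φ' • d‖ ^ 2 / ‖(M s).toEuclideanLin (φ' • d)‖ ^ 2)) • (φ' • d)
          = d) →
        φ' = φ) := by
  set K : ℝ := ∑ j, (c j)⁻¹ + ∑ s, (b s)⁻¹ * (‖d‖ ^ 2 / ‖(M s).toEuclideanLin d‖ ^ 2) with hK
  have hK_pos : 0 < K :=
    add_pos_of_pos_of_nonneg
      (Finset.sum_pos (fun j _ => inv_pos.mpr (hc j)) Finset.univ_nonempty)
      (Finset.sum_nonneg fun s _ => mul_nonneg (inv_pos.mpr (hb s)).le (by positivity))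
  have hφ_pos : 0 < φ := hφ ▸ inv_pos.mpr hK_pos
  have supply (t : ℝ) (ht : t ≠ 0) :
      (∑ j, (c j)⁻¹ • (t • d)) + ∑ s, ((b s)⁻¹ *
        (‖t • d‖ ^ 2 / ‖(M s).toEuclideanLin (t • d)‖ ^ 2)) • (t • d) = (K * t) • d := by
    simp only [norm_smul_sq_div_norm_map_smul_sq _ d ht]
    rw [← Finset.sum_smul, ← Finset.sum_smul, ← add_smul, smul_smul]
  have clearing : (∑ j, α j • lam) + ∑ s, β s • lam = d := by
    simp only [hα, hβ, hlam]
    rw [supply φ hφ_pos.ne', hφ, mul_inv_cancel₀ hK_pos.ne', one_smul]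
  refine ⟨hφ_pos, clearing, ?_, ?_⟩
  · intro dd dr gd ud h_day h_split
    rw [Finset.sum_sub_distrib, Finset.sum_sub_distrib, sub_add_sub_comm, clearing, h_day,
      h_split, add_sub_cancel_left]
  · intro t ht h_clear
    rw [supply t ht] at h_clear
    have h_one : K * t = 1 := smul_left_injective ℝ hd (by simpa using h_clear)
    rw [hφ]
    exact eq_inv_of_mul_eq_one_right h_one
end

section
/- Let T be a positive integer. Let d^r ∈ ℝ^T with d^r ≠ 0 be the real-time demand, and let λ^d ∈ ℝ^T be the day-ahead price vector with ⟨λ^d, d^r⟩ ≥ 0. Let G and S be nonempty finite index sets; for each j ∈ G let c_j > 0 and let the day-ahead commitment be g_j^d = c_j⁻¹ λ^d; for each s ∈ S let b_s > 0, let M_s be a real T×T matrix with M_s d^r ≠ 0, and let θ_s^d ∈ ℝ^T satisfy ⟨θ_s^d, M_s d^r⟩ = ⟨λ^d, d^r⟩ (the day-ahead stationarity relation). Set k = ⟨λ^d, d^r⟩/‖d^r‖², C = Σ_{j∈G} c_j⁻¹, and B = Σ_{s∈S} b_s⁻¹ ‖d^r‖²/‖M_s d^r‖². Then ω = k + 1/(C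 + B) is the unique nonzero real number such that, with λ^r = ω d^r and the bids α_j^r = c_j⁻¹ − ⟨g_j^d, λ^r⟩/‖λ^r‖² and β_s^r = b_s⁻¹ (‖λ^r‖² − ⟨θ_s^d, M_s λ^r⟩)/‖M_s λ^r‖², the real-time market clears: Σ_{j∈G} α_j^r λ^r + Σ_{s∈S} β_s^r λ^r = d^r. -/
open scoped RealInnerProductSpace

/-- In the day-ahead-unaware mixed mechanism (Theorem 3),
`ω = k + 1/(C + B)` is the unique nonzero real number such that, with real-time
prices `λʳ = ω dʳ` and the price-taking optimal bids
`α_jʳ = c_j⁻¹ − ⟨g_jᵈ, λʳ⟩/‖λʳ‖²` and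
`β_sʳ = b_s⁻¹(‖λʳ‖² − ⟨θ_sᵈ, M_s λʳ⟩)/‖M_s λʳ‖²`,
the real-time market clears. -/
theorem da_unaware_equilibrium_price_unique
    (T : ℕ) (hT : 0 < T) (dr : EuclideanSpace ℝ (Fin T)) (hdr : dr ≠ 0)
    (lamd : EuclideanSpace ℝ (Fin T)) (hpos : 0 ≤ ⟪lamd, dr⟫)
    (G S : Type) [Fintype G] [Fintype S] [Nonempty G] [Nonempty S]
    (c : G → ℝ) (hc : ∀ j, 0 < c j)
    (gd : G → EuclideanSpace ℝ (Fin T)) (hgd : ∀ j, gd j = (c j)⁻¹ • lamd)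
    (b : S → ℝ) (hb : ∀ s, 0 < b s)
    (M : S → Matrix (Fin T) (Fin T) ℝ) (hM : ∀ s, (M s).toEuclideanLin dr ≠ 0)
    (θ : S → EuclideanSpace ℝ (Fin T))
    (hθ : ∀ s, ⟪θ s, (M s).toEuclideanLin dr⟫ = ⟪lamd, dr⟫)
    (k C B ω : ℝ)
    (hk : k = ⟪lamd, dr⟫ / ‖dr‖ ^ 2)
    (hC : C = ∑ j, (c j)⁻¹)
    (hB : B = ∑ s, (b s)⁻¹ * (‖dr‖ ^ 2 / ‖(M s).toEuclideanLin dr‖ ^ 2))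
    (hω : ω = k + 1 / (C + B)) :
    ω ≠ 0 ∧
    ((∑ j, ((c j)⁻¹ - ⟪gd j, ω • dr⟫ / ‖ω • dr‖ ^ 2) • (ω • dr)) +
        ∑ s, ((b s)⁻¹ *
            ((‖ω • dr‖ ^ 2 - ⟪θ s, (M s).toEuclideanLin (ω • dr)⟫) /
              ‖(M s).toEuclideanLin (ω • dr)‖ ^ 2)) • (ω • dr)
      = dr) ∧
    (∀ ω' : ℝ, ω' ≠ 0 →
      ((∑ j, ((c j)⁻¹ - ⟪gd j, ω' • dr⟫ / ‖ω' • dr‖ ^ 2) • (ω' • dr)) +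
          ∑ s, ((b s)⁻¹ *
              ((‖ω' • dr‖ ^ 2 - ⟪θ s, (M s).toEuclideanLin (ω' • dr)⟫) /
                ‖(M s).toEuclideanLin (ω' • dr)‖ ^ 2)) • (ω' • dr)
        = dr) →
      ω' = ω) := by
  have hn : 0 < ‖dr‖ := norm_pos_iff.mpr hdr
  have hCpos : 0 < C := hC ▸ Finset.sum_pos (fun j _ => inv_pos.mpr (hc j)) Finset.univ_nonempty
  have hBpos : 0 < B := by
    rw [hB]
    refine Finset.sum_pos (fun s _ => ?_) Finset.univ_nonempty
    have hm : 0 < ‖(M s).toEuclideanLin dr‖ := norm_pos_iff.mpr (hM s)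
    have hbs := hb s
    positivity
  have hCB : 0 < C + B := add_pos hCpos hBpos
  have hk0 : 0 ≤ k := by rw [hk]; positivity
  have hω0 : 0 < ω := by rw [hω]; positivity
  have supply : ∀ x : ℝ, x ≠ 0 →
      ((∑ j, ((c j)⁻¹ - ⟪gd j, x • dr⟫ / ‖x • dr‖ ^ 2) • (x • dr)) +
        ∑ s, ((b s)⁻¹ *
            ((‖x • dr‖ ^ 2 - ⟪θ s, (M s).toEuclideanLin (x • dr)⟫) /
              ‖(M s).toEuclideanLin (x • dr)‖ ^ 2)) • (x • dr)
      = ((C + B) * (x - k)) • dr) := by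
    intro x hx
    rw [add_mul, add_smul, hC, hB, Finset.sum_mul, Finset.sum_mul, Finset.sum_smul,
      Finset.sum_smul]
    congr 1
    · refine Finset.sum_congr rfl fun j _ => ?_
      rw [smul_smul, hgd, real_inner_smul_left, real_inner_smul_right, norm_smul, mul_pow,
        Real.norm_eq_abs, sq_abs, hk]
      congr 1
      have := (hc j).ne'
      field_simp
    · refine Finset.sum_congr rfl fun s _ => ?_
      have hm : ‖(M s).toEuclideanLin dr‖ ≠ 0 := norm_ne_zero_iff.mpr (hM s)
      rw [smul_smul, map_smul, real_inner_smul_right, hθ, norm_smul, norm_smul, mul_pow, mul_pow,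
        Real.norm_eq_abs, sq_abs, hk]
      congr 1
      have := (hb s).ne'
      field_simp
  refine ⟨hω0.ne', ?_, fun x hx hclear => ?_⟩
  · rw [supply ω hω0.ne', hω, add_sub_cancel_left, mul_one_div_cancel hCB.ne', one_smul]
  · rw [supply x hx] at hclear
    have h1 : (C + B) * (x - k) = 1 :=
      smul_left_injective ℝ hdr (hclear.trans (one_smul ℝ dr).symm)
    rw [hω, ← eq_one_div_of_mul_eq_one_right h1]
    ring
end

section
/- Let T be a positive integer, let d^d ∈ ℝ^T, let M be a real T×T matrix, let S be a nonempty finite index set with β_s > 0 for each s ∈ S and B = Σ_{s∈S} β_s, and let G be a finite index set with α_j ≥ 0 for each j ∈ G and A = Σ_{j∈G} α_j > 0. Suppose u* ∈ ℝ^T and δ* ∈ ℝ satisfy ⟨1, u*⟩ = 0 and (d^d − u*)/A = (1/B) MᵀM u* + δ*·1. Define λ = (d^d − u*)/A, and for each j and s set g_j = α_j λ, ε_s = β_s/B, u_s = ε_s u*, ν_s = ε_s M u*, θ_s = (1/B) M u*, and δ_s = δ*. Then all of the following market-clearing (KKT) conditions hold: (i) power balance Σ_{j∈G} g_j + Σ_{s∈S}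 u_s = d^d; (ii) supply-function consistency g_j = α_j λ for all j; (iii) cycle-bid consistency ν_s = M u_s and ν_s = β_s θ_s for all s; (iv) storage stationarity λ = (1/β_s) MᵀM u_s + δ_s·1 for all s; (v) periodicity ⟨1, u_s⟩ = 0 for all s; and (vi) the per-cycle prices are uniform: θ_s = (1/B) M u* is the same vector for every s ∈ S. -/
open scoped RealInnerProductSpace Matrix

/-- Theorem 2, uniform-price day-ahead mechanism: given a
primal-dual pair `(u*, δ*)` for the reduced problem, the proportional
allocation `ε_s = β_s/B`, `u_s = ε_s u*`, `ν_s = ε_s M u*`,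
`θ_s = (1/B) M u*`, `δ_s = δ*`, together with `λ = (d − u*)/A` and
`g_j = α_j λ`, satisfies all the day-ahead market-clearing KKT conditions and
yields uniform per-cycle prices. -/
theorem uniform_price_mechanism_kkt
    (T : ℕ) (hT : 0 < T) (dd : EuclideanSpace ℝ (Fin T))
    (M : Matrix (Fin T) (Fin T) ℝ)
    (G S : Type) [Fintype G] [Fintype S] [Nonempty S]
    (β : S → ℝ) (hβpos : ∀ s, 0 < β s) (B : ℝ) (hB : B = ∑ s, β s)
    (α : G → ℝ) (hαnn : ∀ j, 0 ≤ α j) (A : ℝ) (hA : A = ∑ j, α j) (hApos : 0 < A)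
    (ones : EuclideanSpace ℝ (Fin T)) (hones : ∀ i, ones i = 1)
    (ustar : EuclideanSpace ℝ (Fin T)) (δstar : ℝ)
    (hperiod : ⟪ones, ustar⟫ = 0)
    (hstat : A⁻¹ • (dd - ustar) = B⁻¹ • ((Mᵀ * M).toEuclideanLin ustar) + δstar • ones)
    (lam : EuclideanSpace ℝ (Fin T)) (hlam : lam = A⁻¹ • (dd - ustar))
    (g : G → EuclideanSpace ℝ (Fin T)) (hg : ∀ j, g j = α j • lam)
    (ε : S → ℝ) (hε : ∀ s, ε s = β s / B)
    (u : S → EuclideanSpace ℝ (Fin T)) (hu : ∀ s, u s = ε s • ustar)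
    (ν : S → EuclideanSpace ℝ (Fin T)) (hν : ∀ s, ν s = ε s • M.toEuclideanLin ustar)
    (θ : S → EuclideanSpace ℝ (Fin T)) (hθ : ∀ s, θ s = B⁻¹ • M.toEuclideanLin ustar)
    (δ : S → ℝ) (hδ : ∀ s, δ s = δstar) :
    -- (i) power balance
    ((∑ j, g j) + ∑ s, u s = dd) ∧
    -- (ii) supply-function consistency
    (∀ j, g j = α j • lam) ∧
    -- (iii) cycle-bid consistency
    (∀ s, ν s = M.toEuclideanLin (u s) ∧ ν s = β s • θ s) ∧
    -- (iv) storage stationarity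
    (∀ s, lam = (β s)⁻¹ • ((Mᵀ * M).toEuclideanLin (u s)) + δ s • ones) ∧
    -- (v) periodicity
    (∀ s, ⟪ones, u s⟫ = 0) ∧
    -- (vi) uniform per-cycle prices
    (∀ s s' : S, θ s = θ s') := by
  have hBpos : 0 < B := hB ▸ Finset.sum_pos (fun s _ => hβpos s) Finset.univ_nonempty
  have hεsum : ∑ s, ε s = 1 := by
    simp only [hε, ← Finset.sum_div, ← hB, div_self hBpos.ne']
  refine ⟨?_, hg, fun s => ⟨?_, ?_⟩, fun s => ?_, fun s => ?_, fun s s' => ?_⟩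
  · simp only [hg, hu, ← Finset.sum_smul, hεsum, ← hA, hlam, smul_inv_smul₀ hApos.ne', one_smul,
      sub_add_cancel]
  · rw [hν, hu, map_smul]
  · rw [hν, hθ, hε, smul_smul, div_eq_mul_inv]
  · have hscale : (β s)⁻¹ * ε s = B⁻¹ := by
      rw [hε, div_eq_mul_inv, inv_mul_cancel_left₀ (hβpos s).ne']
    rw [hu, map_smul, smul_smul, hscale, hδ, hlam, hstat]
  · rw [hu, inner_smul_right, hperiod, mul_zero]
  · rw [hθ, hθ]
end
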